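/- In B_G(Υ), set T_i = Σ_{s∈R: v(s)=i} μ_s s̄ − e_i for each i ∈ P. Then: (i) w̄ T_i = T_{w(i)} w̄ for all w ∈ G and i ∈ P; and (ii) for every codimension-2 intersection L of two distinct reflection hyperplanes, setting I_L = {k ∈ P : H_k ⊇ L}, one has [T_a, Σ_{k∈I_L} T_k] = 0 for every a ∈ I_L, where [x,y] = xy − yx. -/

import Mathlib

noncomputable section

open scoped Classical

namespace PRG

variable {V : Type*} [AddCommGroup V] [Module ℂ V]

/-- `s` is a pseudo reflection: an invertible endomorphism of finite order whose fixed
subspace is a hyperplane (a codimension one subspace). -/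
def IsPRefl (s : (Module.End ℂ V)ˣ) : Prop :=
  IsOfFinOrder s ∧
    Module.finrank ℂ (LinearMap.ker ((s : Module.End ℂ V) - 1)) + 1 = Module.finrank ℂ V

/-- The reflection hyperplane of a pseudo reflection: its fixed subspace. -/
def hypOf (s : (Module.End ℂ V)ˣ) : Submodule ℂ V :=
  LinearMap.ker ((s : Module.End ℂ V) - 1)

variable (G : Subgroup (Module.End ℂ V)ˣ)

/-- The set `R` of pseudo reflections contained in `G`. -/
def Rset : Set ↥G := {s | IsPRefl (s : (Module.End ℂ V)ˣ)}

/-- `G` is a pseudo reflection group: it is generated by the pseudo reflections it contains. -/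
def IsPseudoReflectionGroup : Prop :=
  Subgroup.closure {s : (Module.End ℂ V)ˣ | ∃ h : s ∈ G, (⟨s, h⟩ : ↥G) ∈ Rset G} = G

/-- The set `P` of reflection hyperplanes of `G`. -/
def Pset : Set (Submodule ℂ V) := (fun s : ↥G => hypOf (s : (Module.End ℂ V)ˣ)) '' Rset G

/-- The set `R(i,j)` of pseudo reflections of `G` mapping the hyperplane `j` to the
hyperplane `i`. -/
def Rij (i j : Submodule ℂ V) : Set ↥G :=
  {s | s ∈ Rset G ∧ Submodule.map ((s : (Module.End ℂ V)ˣ) : Module.End ℂ V) j = i}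

/-- Conjugacy-class invariance of the parameters `μ`. -/
def MuAdmissible (μ : ↥G → ℂ) : Prop :=
  ∀ s t : ↥G, s ∈ Rset G → t ∈ Rset G → (∃ w : ↥G, w * s * w⁻¹ = t) → μ s = μ t

/-- Orbit invariance of the parameters `m`. -/
def MAdmissible (mc : Submodule ℂ V → ℂ) : Prop :=
  ∀ i j, i ∈ Pset G → j ∈ Pset G →
    (∃ w : ↥G, Submodule.map ((w : (Module.End ℂ V)ˣ) : Module.End ℂ V) i = j) → mc i = mc j

/-- The generator `w̄` of the free algebra, for `w ∈ G`. -/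
def gg (w : ↥G) : FreeAlgebra ℂ (↥G ⊕ ↥(Pset G)) := FreeAlgebra.ι ℂ (Sum.inl w)

/-- The generator `e_i` of the free algebra, for `i ∈ P`. -/
def ee (i : ↥(Pset G)) : FreeAlgebra ℂ (↥G ⊕ ↥(Pset G)) := FreeAlgebra.ι ℂ (Sum.inr i)

/-- The defining relations of the algebra `B_G(Υ)` (Definition 5.1). -/
inductive BRel (μ : ↥G → ℂ) (mc : Submodule ℂ V → ℂ) :
    FreeAlgebra ℂ (↥G ⊕ ↥(Pset G)) → FreeAlgebra ℂ (↥G ⊕ ↥(Pset G)) → Prop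
  | grp_one : BRel μ mc (gg G 1) 1
  | grp_mul (w₁ w₂ : ↥G) : BRel μ mc (gg G w₁ * gg G w₂) (gg G (w₁ * w₂))
  | refl_e (s : ↥G) (i : ↥(Pset G)) (hs : s ∈ Rset G)
      (hhyp : hypOf (s : (Module.End ℂ V)ˣ) = (i : Submodule ℂ V)) :
      BRel μ mc (gg G s * ee G i) (ee G i)
  | e_refl (s : ↥G) (i : ↥(Pset G)) (hs : s ∈ Rset G)
      (hhyp : hypOf (s : (Module.End ℂ V)ˣ) = (i : Submodule ℂ V)) :
      BRel μ mc (ee G i * gg G s) (ee G i)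
  | e_sq (i : ↥(Pset G)) : BRel μ mc (ee G i * ee G i) (mc (i : Submodule ℂ V) • ee G i)
  | move (w : ↥G) (i j : ↥(Pset G))
      (h : Submodule.map ((w : (Module.End ℂ V)ˣ) : Module.End ℂ V) (j : Submodule ℂ V)
        = (i : Submodule ℂ V)) :
      BRel μ mc (gg G w * ee G j) (ee G i * gg G w)
  | e_comm (i j : ↥(Pset G))
      (h : {k : ↥(Pset G) | (i : Submodule ℂ V) ⊓ (j : Submodule ℂ V) ≤ (k : Submodule ℂ V)}
        = {i, j}) :
      BRel μ mc (ee G i * ee G j) (ee G j * ee G i)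
  | e_sum (i j : ↥(Pset G))
      (h : {k : ↥(Pset G) | (i : Submodule ℂ V) ⊓ (j : Submodule ℂ V) ≤ (k : Submodule ℂ V)}
        ≠ {i, j})
      (h2 : (Rij G (i : Submodule ℂ V) (j : Submodule ℂ V)).Nonempty) :
      BRel μ mc (ee G i * ee G j)
        ((∑ᶠ s ∈ Rij G (i : Submodule ℂ V) (j : Submodule ℂ V), μ s • gg G s) * ee G j)
  | e_zero (i j : ↥(Pset G))
      (h : {k : ↥(Pset G) | (i : Submodule ℂ V) ⊓ (j : Submodule ℂ V) ≤ (k : Submodule ℂ V)}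
        ≠ {i, j})
      (h2 : Rij G (i : Submodule ℂ V) (j : Submodule ℂ V) = ∅) :
      BRel μ mc (ee G i * ee G j) 0

/-- The algebra `B_G(Υ)` associated with the pseudo reflection group `G` and the
parameters `Υ = (μ, m)` (Definition 5.1). -/
def BAlg (μ : ↥G → ℂ) (mc : Submodule ℂ V → ℂ) : Type _ := RingQuot (BRel G μ mc)

instance (μ : ↥G → ℂ) (mc : Submodule ℂ V → ℂ) : Ring (BAlg G μ mc) :=
  inferInstanceAs (Ring (RingQuot (BRel G μ mc)))

instance (μ : ↥G → ℂ) (mc : Submodule ℂ V → ℂ) : Algebra ℂ (BAlg G μ mc) :=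
  inferInstanceAs (Algebra ℂ (RingQuot (BRel G μ mc)))

variable (μ : ↥G → ℂ) (mc : Submodule ℂ V → ℂ)

/-- The image `w̄ ∈ B_G(Υ)` of a group element `w ∈ G`. -/
def wbar (w : ↥G) : BAlg G μ mc := RingQuot.mkAlgHom ℂ (BRel G μ mc) (gg G w)

/-- The generator `e_i ∈ B_G(Υ)` for a reflection hyperplane `i ∈ P`. -/
def ebar (i : ↥(Pset G)) : BAlg G μ mc := RingQuot.mkAlgHom ℂ (BRel G μ mc) (ee G i)

/-- `w ↦ w̄` as a monoid homomorphism `G →* B_G(Υ)`. -/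
def wbarMonoidHom : ↥G →* BAlg G μ mc where
  toFun := wbar G μ mc
  map_one' := by
    have h := RingQuot.mkAlgHom_rel ℂ (BRel.grp_one (G := G) (μ := μ) (mc := mc))
    rw [map_one] at h
    exact h
  map_mul' w₁ w₂ := by
    have h := RingQuot.mkAlgHom_rel ℂ (BRel.grp_mul (μ := μ) (mc := mc) w₁ w₂)
    rw [map_mul] at h
    exact h.symm

/-- The natural algebra homomorphism `ℂG → B_G(Υ)` induced by `w ↦ w̄`. -/
def groupAlgebraMap : MonoidAlgebra ℂ ↥G →ₐ[ℂ] BAlg G μ mc :=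
  MonoidAlgebra.lift ℂ (BAlg G μ mc) ↥G (wbarMonoidHom G μ mc)

end PRG

namespace PRG

theorem finsum_mem_filter_aux {α M : Type*} [Fintype α] [AddCommMonoid M] (A : Set α)
    (f : α → M) : (∑ᶠ s ∈ A, f s) = ∑ s ∈ Finset.univ.filter (· ∈ A), f s := by
  rw [finsum_mem_eq_finite_toFinset_sum f (Set.toFinite A)]
  congr 1
  ext x
  simp

section

variable {V : Type*} [AddCommGroup V] [Module ℂ V]

theorem mem_hypOf (s : (Module.End ℂ V)ˣ) (x : V) :
    x ∈ hypOf s ↔ (s : Module.End ℂ V) x = x := by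
  simp [hypOf, sub_eq_zero]

theorem val_inv_apply (w : (Module.End ℂ V)ˣ) (x : V) :
    (w : Module.End ℂ V) (((w⁻¹ : (Module.End ℂ V)ˣ) : Module.End ℂ V) x) = x := by
  rw [← Module.End.mul_apply, Units.mul_inv, Module.End.one_apply]

theorem inv_val_apply (w : (Module.End ℂ V)ˣ) (x : V) :
    ((w⁻¹ : (Module.End ℂ V)ˣ) : Module.End ℂ V) ((w : Module.End ℂ V) x) = x := by
  rw [← Module.End.mul_apply, Units.inv_mul, Module.End.one_apply]

theorem unit_inj (w : (Module.End ℂ V)ˣ) : Function.Injective (w : Module.End ℂ V) :=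
  Function.LeftInverse.injective (inv_val_apply w)

theorem map_hypOf (w s : (Module.End ℂ V)ˣ) :
    Submodule.map (w : Module.End ℂ V) (hypOf s) = hypOf (w * s * w⁻¹) := by
  ext x
  simp only [Submodule.mem_map, mem_hypOf, Units.val_mul, Module.End.mul_apply]
  constructor
  · rintro ⟨y, hy, rfl⟩
    rw [inv_val_apply, hy]
  · intro h
    refine ⟨((w⁻¹ : (Module.End ℂ V)ˣ) : Module.End ℂ V) x, ?_, val_inv_apply w x⟩
    apply unit_inj w
    rw [h, val_inv_apply]

theorem map_mul_unit (w v : (Module.End ℂ V)ˣ) (H : Submodule ℂ V) :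
    Submodule.map ((w * v : (Module.End ℂ V)ˣ) : Module.End ℂ V) H
      = Submodule.map (w : Module.End ℂ V) (Submodule.map (v : Module.End ℂ V) H) := by
  rw [← Submodule.map_comp]
  rfl

theorem map_one_unit (H : Submodule ℂ V) :
    Submodule.map ((1 : (Module.End ℂ V)ˣ) : Module.End ℂ V) H = H := by
  ext x
  simp

theorem IsPRefl_conj (w s : (Module.End ℂ V)ˣ) (hs : IsPRefl s) : IsPRefl (w * s * w⁻¹) := by
  refine ⟨?_, ?_⟩
  · have := hs.1
    rw [isOfFinOrder_iff_pow_eq_one] at this ⊢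
    obtain ⟨n, hn, h⟩ := this
    exact ⟨n, hn, by rw [conj_pow, h]; simp⟩
  · have h := hs.2
    have e : Module.finrank ℂ (Submodule.map (w : Module.End ℂ V) (hypOf s))
        = Module.finrank ℂ (hypOf s) :=
      (Submodule.equivMapOfInjective (w : Module.End ℂ V) (unit_inj w) (hypOf s)).finrank_eq.symm
    rw [map_hypOf] at e
    change Module.finrank ℂ (hypOf (w * s * w⁻¹)) + 1 = _
    rw [e]
    exact h

theorem finrank_inf_hyp [FiniteDimensional ℂ V] {H K : Submodule ℂ V}
    (hH : Module.finrank ℂ H + 1 = Module.finrank ℂ V)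
    (hK : Module.finrank ℂ K + 1 = Module.finrank ℂ V) (hne : H ≠ K) :
    Module.finrank ℂ (H ⊓ K : Submodule ℂ V) + 2 = Module.finrank ℂ V := by
  have h1 := Submodule.finrank_sup_add_finrank_inf_eq H K
  have h2 : H < H ⊔ K := by
    refine lt_of_le_of_ne le_sup_left ?_
    intro h
    have hle : K ≤ H := by rw [h]; exact le_sup_right
    exact hne (Submodule.eq_of_le_of_finrank_eq hle (by omega)).symm
  have h3 := Submodule.finrank_lt_finrank_of_lt h2
  have h4 := Submodule.finrank_le (H ⊔ K)
  omega

variable (G : Subgroup (Module.End ℂ V)ˣ)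

theorem finrank_Pset (i : ↥(Pset G)) :
    Module.finrank ℂ (i : Submodule ℂ V) + 1 = Module.finrank ℂ V := by
  obtain ⟨_, s, hs, rfl⟩ := i
  exact hs.2

theorem inf_eq_inf [FiniteDimensional ℂ V] {i j k l : ↥(Pset G)} (hij : i ≠ j) (hkl : k ≠ l)
    (hk : (i : Submodule ℂ V) ⊓ (j : Submodule ℂ V) ≤ k)
    (hl : (i : Submodule ℂ V) ⊓ (j : Submodule ℂ V) ≤ l) :
    (i : Submodule ℂ V) ⊓ (j : Submodule ℂ V) = (k : Submodule ℂ V) ⊓ (l : Submodule ℂ V) := by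
  have h1 := finrank_inf_hyp (finrank_Pset G i) (finrank_Pset G j)
    (fun h => hij (Subtype.ext h))
  have h2 := finrank_inf_hyp (finrank_Pset G k) (finrank_Pset G l)
    (fun h => hkl (Subtype.ext h))
  exact Submodule.eq_of_le_of_finrank_eq (le_inf hk hl) (by omega)

/-- The action of `G` on the set of hyperplanes. -/
def act (w : ↥G) (i : ↥(Pset G)) : ↥(Pset G) :=
  ⟨Submodule.map ((w : (Module.End ℂ V)ˣ) : Module.End ℂ V) (i : Submodule ℂ V), by
    obtain ⟨_, s, hs, rfl⟩ := i
    exact ⟨w * s * w⁻¹, IsPRefl_conj (w : (Module.End ℂ V)ˣ) s hs,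
      (map_hypOf (w : (Module.End ℂ V)ˣ) s).symm⟩⟩

theorem act_mul (w v : ↥G) (i : ↥(Pset G)) : act G (w * v) i = act G w (act G v i) :=
  Subtype.ext (map_mul_unit _ _ _)

theorem act_one (i : ↥(Pset G)) : act G 1 i = i :=
  Subtype.ext (map_one_unit _)

theorem act_inv_act (w : ↥G) (i : ↥(Pset G)) : act G w⁻¹ (act G w i) = i := by
  rw [← act_mul, inv_mul_cancel, act_one]

theorem act_act_inv (w : ↥G) (i : ↥(Pset G)) : act G w (act G w⁻¹ i) = i := by
  rw [← act_mul, mul_inv_cancel, act_one]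

/-- A reflection fixing `L` pointwise preserves the set of hyperplanes containing `L`. -/
theorem act_le {L : Submodule ℂ V} {s : ↥G} (hs : L ≤ hypOf (s : (Module.End ℂ V)ˣ))
    {k : ↥(Pset G)} (hk : L ≤ k) : L ≤ act G s k := by
  intro x hx
  exact ⟨x, hk hx, (mem_hypOf _ _).1 (hs hx)⟩

theorem le_hypOf_inv {L : Submodule ℂ V} {s : ↥G} (hs : L ≤ hypOf (s : (Module.End ℂ V)ˣ)) :
    L ≤ hypOf ((s⁻¹ : ↥G) : (Module.End ℂ V)ˣ) := by
  intro x hx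
  have h := (mem_hypOf _ _).1 (hs hx)
  rw [mem_hypOf]
  conv_lhs => rw [← h]
  exact inv_val_apply _ _

theorem act_self {s : ↥G} {k : ↥(Pset G)}
    (hs : hypOf (s : (Module.End ℂ V)ˣ) = k) : act G s k = k := by
  apply Subtype.ext
  change Submodule.map _ _ = _
  rw [← hs, map_hypOf]
  simp

/-- If `s` moves `a` to a different hyperplane containing `L`, then `L ⊆ H_s`. -/
theorem le_hypOf_of_act [FiniteDimensional ℂ V] {i j a : ↥(Pset G)} (hij : i ≠ j)
    {s : ↥G} (hs : s ∈ Rset G) (hne : act G s a ≠ a)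
    (ha : (i : Submodule ℂ V) ⊓ (j : Submodule ℂ V) ≤ a)
    (hsa : (i : Submodule ℂ V) ⊓ (j : Submodule ℂ V) ≤ act G s a) :
    (i : Submodule ℂ V) ⊓ (j : Submodule ℂ V) ≤ hypOf (s : (Module.End ℂ V)ˣ) := by
  set k : ↥(Pset G) := ⟨hypOf (s : (Module.End ℂ V)ˣ), s, hs, rfl⟩ with hk
  have hka : k ≠ a := by
    intro h
    exact hne (act_self G (congrArg Subtype.val h))
  have h1 : (k : Submodule ℂ V) ⊓ (a : Submodule ℂ V) ≤ act G s a := by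
    rintro x ⟨hx1, hx2⟩
    exact ⟨x, hx2, (mem_hypOf _ _).1 hx1⟩
  have h2 := inf_eq_inf G hka hne h1 inf_le_right
  have h3 := inf_eq_inf G hij hne hsa ha
  rw [h3, ← h2]
  exact inf_le_left

variable (μ : ↥G → ℂ) (mc : Submodule ℂ V → ℂ)

theorem wbar_mul (w v : ↥G) : wbar G μ mc w * wbar G μ mc v = wbar G μ mc (w * v) :=
  ((wbarMonoidHom G μ mc).map_mul w v).symm

theorem wbar_one : wbar G μ mc 1 = 1 := (wbarMonoidHom G μ mc).map_one

theorem wbar_ebar (w : ↥G) (i : ↥(Pset G)) :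
    wbar G μ mc w * ebar G μ mc i = ebar G μ mc (act G w i) * wbar G μ mc w := by
  have h := RingQuot.mkAlgHom_rel ℂ (BRel.move (μ := μ) (mc := mc) w (act G w i) i rfl)
  rw [map_mul, map_mul] at h
  exact h

theorem ebar_comm (i j : ↥(Pset G))
    (h : {k : ↥(Pset G) | (i : Submodule ℂ V) ⊓ (j : Submodule ℂ V) ≤ (k : Submodule ℂ V)}
        = {i, j}) :
    ebar G μ mc i * ebar G μ mc j = ebar G μ mc j * ebar G μ mc i := by
  have h := RingQuot.mkAlgHom_rel ℂ (BRel.e_comm (μ := μ) (mc := mc) i j h)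
  rw [map_mul, map_mul] at h
  exact h

theorem ebar_mul [Fintype ↥G] (i j : ↥(Pset G))
    (h : {k : ↥(Pset G) | (i : Submodule ℂ V) ⊓ (j : Submodule ℂ V) ≤ (k : Submodule ℂ V)}
        ≠ {i, j}) :
    ebar G μ mc i * ebar G μ mc j =
      ∑ s : ↥G with (s ∈ Rset G ∧ act G s j = i), μ s • (wbar G μ mc s * ebar G μ mc j) := by
  have key : ∀ s : ↥G, s ∈ Rij G (i : Submodule ℂ V) (j : Submodule ℂ V) ↔
      (s ∈ Rset G ∧ act G s j = i) := by
    intro s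
    exact and_congr_right fun _ => (Subtype.ext_iff (a1 := act G s j) (a2 := i)).symm
  rcases (Rij G (i : Submodule ℂ V) (j : Submodule ℂ V)).eq_empty_or_nonempty with h2 | h2
  · have h := RingQuot.mkAlgHom_rel ℂ (BRel.e_zero (μ := μ) (mc := mc) i j h h2)
    rw [map_mul, map_zero] at h
    rw [Finset.sum_eq_zero]
    · exact h
    · intro s hs
      have := (key s).2 (Finset.mem_filter.1 hs).2
      rw [h2] at this
      exact this.elim
  · have h := RingQuot.mkAlgHom_rel ℂ (BRel.e_sum (μ := μ) (mc := mc) i j h h2)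
    rw [finsum_mem_filter_aux, map_mul, map_mul, map_sum, Finset.sum_mul] at h
    refine h.trans ?_
    refine Finset.sum_congr (Finset.filter_congr fun s _ => key s) fun s _ => ?_
    rw [map_smul, smul_mul_assoc]
    rfl

/-- The element `S_i`. -/
def Sel [Fintype ↥G] (i : ↥(Pset G)) : BAlg G μ mc :=
  ∑ s : ↥G with (s ∈ Rset G ∧ hypOf (s : (Module.End ℂ V)ˣ) = (i : Submodule ℂ V)),
    μ s • wbar G μ mc s

theorem wbar_Sel [Fintype ↥G] (hμ : MuAdmissible G μ) (w : ↥G) (i : ↥(Pset G)) :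
    wbar G μ mc w * Sel G μ mc i = Sel G μ mc (act G w i) * wbar G μ mc w := by
  unfold Sel
  rw [Finset.mul_sum, Finset.sum_mul]
  refine Finset.sum_bij' (fun s _ => w * s * w⁻¹) (fun s _ => w⁻¹ * s * w) ?_ ?_ ?_ ?_ ?_
  · intro s hs
    obtain ⟨h1, h2⟩ := (Finset.mem_filter.1 hs).2
    refine Finset.mem_filter.2 ⟨Finset.mem_univ _, IsPRefl_conj (w : (Module.End ℂ V)ˣ) s h1, ?_⟩
    change _ = Submodule.map _ _
    rw [← h2, map_hypOf]
    rfl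
  · intro s hs
    obtain ⟨h1, h2⟩ := (Finset.mem_filter.1 hs).2
    refine Finset.mem_filter.2 ⟨Finset.mem_univ _, ?_, ?_⟩
    · have := IsPRefl_conj ((w⁻¹ : ↥G) : (Module.End ℂ V)ˣ) s h1
      simpa [Rset] using this
    · have h3 := congrArg Subtype.val (act_inv_act G w i)
      change Submodule.map _ (act G w i : Submodule ℂ V) = _ at h3
      rw [← h2, map_hypOf] at h3
      simpa using h3
  · intro s _
    group
  · intro s _
    group
  · intro s hs
    obtain ⟨h1, h2⟩ := (Finset.mem_filter.1 hs).2
    rw [mul_smul_comm, smul_mul_assoc, wbar_mul, wbar_mul,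
      hμ s (w * s * w⁻¹) h1 (IsPRefl_conj (w : (Module.End ℂ V)ˣ) s h1) ⟨w, rfl⟩]
    congr 2
    group

/-- The element `T_i`. -/
def Tel [Fintype ↥G] (i : ↥(Pset G)) : BAlg G μ mc := Sel G μ mc i - ebar G μ mc i

theorem wbar_Tel [Fintype ↥G] (hμ : MuAdmissible G μ) (w : ↥G) (i : ↥(Pset G)) :
    wbar G μ mc w * Tel G μ mc i = Tel G μ mc (act G w i) * wbar G μ mc w := by
  unfold Tel
  rw [mul_sub, sub_mul, wbar_Sel G μ mc hμ, wbar_ebar]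

theorem Tel_eq [Fintype ↥G] (i : ↥(Pset G)) :
    (∑ᶠ s ∈ {s : ↥G | s ∈ Rset G ∧ hypOf (s : (Module.End ℂ V)ˣ) = (i : Submodule ℂ V)},
      μ s • wbar G μ mc s) - ebar G μ mc i = Tel G μ mc i := by
  rw [finsum_mem_filter_aux]
  unfold Tel Sel
  congr 1
  refine Finset.sum_congr ?_ fun _ _ => rfl
  ext s
  simp

theorem sum_Sel [Fintype ↥G] [Fintype ↥(Pset G)] (L : Submodule ℂ V) :
    ∑ k ∈ Finset.univ.filter (fun k : ↥(Pset G) => L ≤ k), Sel G μ mc k =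
      ∑ s : ↥G with (s ∈ Rset G ∧ L ≤ hypOf (s : (Module.End ℂ V)ˣ)), μ s • wbar G μ mc s := by
  unfold Sel
  rw [Finset.sum_sigma']
  refine Finset.sum_bij (fun x _ => x.2) ?_ ?_ ?_ ?_
  · rintro ⟨k, s⟩ h
    simp only [Finset.mem_sigma, Finset.mem_filter, Finset.mem_univ, true_and] at h ⊢
    exact ⟨h.2.1, h.2.2 ▸ h.1⟩
  · rintro ⟨k, s⟩ h ⟨k', s'⟩ h' hss
    simp only [Finset.mem_sigma, Finset.mem_filter, Finset.mem_univ, true_and] at h h' hss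
    subst hss
    have : k = k' := Subtype.ext (h.2.2.symm.trans h'.2.2)
    subst this
    rfl
  · intro s hs
    simp only [Finset.mem_filter, Finset.mem_univ, true_and] at hs
    refine ⟨⟨⟨_, s, hs.1, rfl⟩, s⟩, ?_, rfl⟩
    simp only [Finset.mem_sigma, Finset.mem_filter, Finset.mem_univ, true_and]
    exact ⟨hs.2, hs.1, trivial⟩
  · intro _ _
    rfl

theorem wbar_comm_sum [Fintype ↥G] [Fintype ↥(Pset G)] (hμ : MuAdmissible G μ)
    (L : Submodule ℂ V) (s : ↥G) (hs : L ≤ hypOf (s : (Module.End ℂ V)ˣ)) :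
    wbar G μ mc s * ∑ k ∈ Finset.univ.filter (fun k : ↥(Pset G) => L ≤ k), Tel G μ mc k =
      (∑ k ∈ Finset.univ.filter (fun k : ↥(Pset G) => L ≤ k), Tel G μ mc k) * wbar G μ mc s := by
  rw [Finset.mul_sum, Finset.sum_mul]
  refine Finset.sum_bij' (fun k _ => act G s k) (fun k _ => act G s⁻¹ k) ?_ ?_ ?_ ?_ ?_
  · intro k hk
    exact Finset.mem_filter.2 ⟨Finset.mem_univ _, act_le G hs (Finset.mem_filter.1 hk).2⟩
  · intro k hk
    exact Finset.mem_filter.2 ⟨Finset.mem_univ _,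
      act_le G (le_hypOf_inv G hs) (Finset.mem_filter.1 hk).2⟩
  · intro k _
    exact act_inv_act G s k
  · intro k _
    exact act_act_inv G s k
  · intro k _
    exact wbar_Tel G μ mc hμ s k

theorem Sel_comm_sum [Fintype ↥G] [Fintype ↥(Pset G)] (hμ : MuAdmissible G μ)
    (L : Submodule ℂ V) (a : ↥(Pset G)) (ha : L ≤ a) :
    Sel G μ mc a * ∑ k ∈ Finset.univ.filter (fun k : ↥(Pset G) => L ≤ k), Tel G μ mc k =
      (∑ k ∈ Finset.univ.filter (fun k : ↥(Pset G) => L ≤ k), Tel G μ mc k) * Sel G μ mc a := by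
  conv_lhs => unfold Sel
  conv_rhs => rw [Sel]
  rw [Finset.sum_mul, Finset.mul_sum]
  refine Finset.sum_congr rfl fun s hs => ?_
  have h := (Finset.mem_filter.1 hs).2.2
  rw [smul_mul_assoc, mul_smul_comm, wbar_comm_sum G μ mc hμ L s (h ▸ ha)]

/-- Left products, generic case. -/
theorem sum_ebar_mul [FiniteDimensional ℂ V] [Fintype ↥G] [Fintype ↥(Pset G)]
    (i j a : ↥(Pset G)) (hij : i ≠ j) (L : Submodule ℂ V)
    (hL : L = (i : Submodule ℂ V) ⊓ (j : Submodule ℂ V)) (ha : L ≤ a)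
    (h3 : ∀ k : ↥(Pset G), L ≤ k → k ≠ a → {l : ↥(Pset G) | L ≤ l} ≠ {k, a}) :
    ∑ k ∈ (Finset.univ.filter fun k : ↥(Pset G) => L ≤ k).erase a,
        ebar G μ mc k * ebar G μ mc a =
      ∑ s : ↥G with ((s ∈ Rset G ∧ L ≤ hypOf (s : (Module.End ℂ V)ˣ)) ∧ ¬ act G s a = a),
        μ s • (wbar G μ mc s * ebar G μ mc a) := by
  subst hL
  rw [← Finset.sum_fiberwise_of_maps_to (g := fun s => act G s a)
    (t := (Finset.univ.filter fun k : ↥(Pset G) =>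
      (i : Submodule ℂ V) ⊓ (j : Submodule ℂ V) ≤ k).erase a)]
  · refine Finset.sum_congr rfl fun k hk => ?_
    obtain ⟨hka, hk⟩ := Finset.mem_erase.1 hk
    have hk := (Finset.mem_filter.1 hk).2
    have h4 := h3 k hk hka
    rw [inf_eq_inf G hij hka hk ha] at h4
    rw [ebar_mul G μ mc k a h4, Finset.filter_filter]
    refine Finset.sum_congr (Finset.filter_congr fun s _ => ?_) fun _ _ => rfl
    constructor
    · rintro ⟨hs, rfl⟩
      exact ⟨⟨⟨hs, le_hypOf_of_act G hij hs hka ha hk⟩, hka⟩, rfl⟩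
    · rintro ⟨⟨⟨hs, _⟩, _⟩, h⟩
      exact ⟨hs, h⟩
  · intro s hs
    obtain ⟨⟨h1, h2⟩, h3⟩ := (Finset.mem_filter.1 hs).2
    exact Finset.mem_erase.2 ⟨h3, Finset.mem_filter.2 ⟨Finset.mem_univ _, act_le G h2 ha⟩⟩

/-- Right products, generic case. -/
theorem sum_mul_ebar [FiniteDimensional ℂ V] [Fintype ↥G] [Fintype ↥(Pset G)]
    (i j a : ↥(Pset G)) (hij : i ≠ j) (L : Submodule ℂ V)
    (hL : L = (i : Submodule ℂ V) ⊓ (j : Submodule ℂ V)) (ha : L ≤ a)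
    (h3 : ∀ k : ↥(Pset G), L ≤ k → k ≠ a → {l : ↥(Pset G) | L ≤ l} ≠ {k, a}) :
    ∑ k ∈ (Finset.univ.filter fun k : ↥(Pset G) => L ≤ k).erase a,
        ebar G μ mc a * ebar G μ mc k =
      ∑ s : ↥G with ((s ∈ Rset G ∧ L ≤ hypOf (s : (Module.End ℂ V)ˣ)) ∧ ¬ act G s a = a),
        μ s • (ebar G μ mc a * wbar G μ mc s) := by
  subst hL
  rw [← Finset.sum_fiberwise_of_maps_to (g := fun s => act G s⁻¹ a)
    (t := (Finset.univ.filter fun k : ↥(Pset G) =>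
      (i : Submodule ℂ V) ⊓ (j : Submodule ℂ V) ≤ k).erase a)]
  · refine Finset.sum_congr rfl fun k hk => ?_
    obtain ⟨hka, hk⟩ := Finset.mem_erase.1 hk
    have hk := (Finset.mem_filter.1 hk).2
    have h4 := h3 k hk hka
    rw [Set.pair_comm, inf_eq_inf G hij hka.symm ha hk] at h4
    rw [ebar_mul G μ mc a k h4, Finset.filter_filter]
    refine Finset.sum_congr (Finset.filter_congr fun s _ => ?_) fun s hs => ?_
    · constructor
      · rintro ⟨hs, h⟩
        have h5 : act G s⁻¹ a = k := by rw [← h, act_inv_act]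
        refine ⟨⟨⟨hs, ?_⟩, ?_⟩, h5⟩
        · exact le_hypOf_of_act G hij hs (by rw [h]; exact hka.symm) hk (by rw [h]; exact ha)
        · intro h6
          apply hka
          rw [← h5]
          conv_lhs => rw [← h6]
          exact act_inv_act G s a
      · rintro ⟨⟨⟨hs, _⟩, _⟩, h⟩
        exact ⟨hs, by rw [← h, act_act_inv]⟩
    · have h := (Finset.mem_filter.1 hs).2.2
      have h' : act G s k = a := by rw [← h, act_act_inv]
      rw [wbar_ebar, h']
  · intro s hs
    obtain ⟨⟨h1, h2⟩, h3⟩ := (Finset.mem_filter.1 hs).2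
    refine Finset.mem_erase.2 ⟨?_, Finset.mem_filter.2 ⟨Finset.mem_univ _,
      act_le G (le_hypOf_inv G h2) ha⟩⟩
    intro h
    apply h3
    conv_lhs => rw [← h]
    exact act_act_inv G s a

theorem ebar_comm_sum [FiniteDimensional ℂ V] [Fintype ↥G] [Fintype ↥(Pset G)]
    (i j a : ↥(Pset G)) (hij : i ≠ j) (L : Submodule ℂ V)
    (hL : L = (i : Submodule ℂ V) ⊓ (j : Submodule ℂ V)) (ha : L ≤ a) :
    ebar G μ mc a * ∑ k ∈ Finset.univ.filter (fun k : ↥(Pset G) => L ≤ k), Tel G μ mc k =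
      (∑ k ∈ Finset.univ.filter (fun k : ↥(Pset G) => L ≤ k), Tel G μ mc k) * ebar G μ mc a := by
  have hsum : ∑ k ∈ Finset.univ.filter (fun k : ↥(Pset G) => L ≤ k), Tel G μ mc k =
      (∑ s : ↥G with (s ∈ Rset G ∧ L ≤ hypOf (s : (Module.End ℂ V)ˣ)), μ s • wbar G μ mc s)
      - (∑ k ∈ (Finset.univ.filter fun k : ↥(Pset G) => L ≤ k).erase a, ebar G μ mc k)
      - ebar G μ mc a := by
    unfold Tel
    rw [Finset.sum_sub_distrib, sum_Sel, sub_sub, Finset.sum_erase_add]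
    exact Finset.mem_filter.2 ⟨Finset.mem_univ _, ha⟩
  rw [hsum, mul_sub, sub_mul]
  congr 1
  rw [mul_sub, sub_mul, Finset.mul_sum, Finset.sum_mul, Finset.mul_sum, Finset.sum_mul]
  by_cases h3 : ∀ k : ↥(Pset G), L ≤ k → k ≠ a → {l : ↥(Pset G) | L ≤ l} ≠ {k, a}
  · rw [sum_ebar_mul G μ mc i j a hij L hL ha h3, sum_mul_ebar G μ mc i j a hij L hL ha h3,
      ← Finset.sum_filter_add_sum_filter_not _ (fun s => act G s a = a),
      ← Finset.sum_filter_add_sum_filter_not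
        (Finset.univ.filter fun s : ↥G => s ∈ Rset G ∧ L ≤ hypOf (s : (Module.End ℂ V)ˣ))
        (fun s => act G s a = a) (fun s => (μ s • wbar G μ mc s) * ebar G μ mc a),
      Finset.filter_filter, Finset.filter_filter]
    simp only [smul_mul_assoc, mul_smul_comm, add_sub_cancel_right]
    refine Finset.sum_congr rfl fun s hs => ?_
    rw [wbar_ebar, (Finset.mem_filter.1 hs).2.2]
  · push Not at h3
    obtain ⟨b, hb, hba, hset⟩ := h3
    have hmem : ∀ l : ↥(Pset G), L ≤ l → l = b ∨ l = a := by
      intro l hl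
      have : l ∈ ({b, a} : Set ↥(Pset G)) := hset ▸ hl
      exact this
    congr 1
    · refine Finset.sum_congr rfl fun s hs => ?_
      obtain ⟨h1, h2⟩ := (Finset.mem_filter.1 hs).2
      rw [smul_mul_assoc, mul_smul_comm, wbar_ebar]
      suffices h : act G s a = a by rw [h]
      rcases hmem ⟨_, s, h1, rfl⟩ h2 with h | h
      · rcases hmem _ (act_le G h2 ha) with h' | h'
        · exfalso
          apply hba
          have h5 : act G s b = b := act_self G (congrArg Subtype.val h)
          rw [← act_inv_act G s b, h5, ← h', act_inv_act]
        · exact h'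
      · exact act_self G (congrArg Subtype.val h)
    · refine Finset.sum_congr rfl fun k hk => ?_
      obtain ⟨hka, hk⟩ := Finset.mem_erase.1 hk
      have hk := (Finset.mem_filter.1 hk).2
      apply ebar_comm
      have hkb : k = b := (hmem k hk).resolve_right hka
      rw [hkb, Set.pair_comm, ← hset, hL]
      rw [hL] at ha hb
      rw [inf_eq_inf G hij hba.symm ha hb]

end

end PRG

open PRG in
/-- in `B_G(Υ)` the elements `T_i = Σ_{s : v(s)=i} μ_s s̄ − e_i` satisfy
(i) `w̄ T_i = T_{w(i)} w̄` and (ii) the Kohno integrability relations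
`[T_a, Σ_{k ∈ I_L} T_k] = 0` for every codimension-2 intersection `L` of two distinct
reflection hyperplanes and every `a ∈ I_L`. -/
theorem BAlg_connection_flat_and_invariant
    {V : Type*} [AddCommGroup V] [Module ℂ V] [FiniteDimensional ℂ V]
    (G : Subgroup (Module.End ℂ V)ˣ) [Finite ↥G]
    (hG : IsPseudoReflectionGroup G)
    (μ : ↥G → ℂ) (mc : Submodule ℂ V → ℂ)
    (hμ : MuAdmissible G μ) (hm : MAdmissible G mc) :
    (∀ (w : ↥G) (i j : ↥(Pset G)),
      Submodule.map ((w : (Module.End ℂ V)ˣ) : Module.End ℂ V) (i : Submodule ℂ V)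
          = (j : Submodule ℂ V) →
        wbar G μ mc w *
          ((∑ᶠ s ∈ {s : ↥G | s ∈ Rset G ∧ hypOf (s : (Module.End ℂ V)ˣ) = (i : Submodule ℂ V)},
              μ s • wbar G μ mc s) - ebar G μ mc i)
        = ((∑ᶠ s ∈ {s : ↥G | s ∈ Rset G ∧
              hypOf (s : (Module.End ℂ V)ˣ) = (j : Submodule ℂ V)},
              μ s • wbar G μ mc s) - ebar G μ mc j) * wbar G μ mc w) ∧
    (∀ i j : ↥(Pset G), i ≠ j → ∀ a : ↥(Pset G),
      (i : Submodule ℂ V) ⊓ (j : Submodule ℂ V) ≤ (a : Submodule ℂ V) →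
      ((∑ᶠ s ∈ {s : ↥G | s ∈ Rset G ∧ hypOf (s : (Module.End ℂ V)ˣ) = (a : Submodule ℂ V)},
          μ s • wbar G μ mc s) - ebar G μ mc a) *
        (∑ᶠ k ∈ {k : ↥(Pset G) |
            (i : Submodule ℂ V) ⊓ (j : Submodule ℂ V) ≤ (k : Submodule ℂ V)},
          ((∑ᶠ s ∈ {s : ↥G | s ∈ Rset G ∧
              hypOf (s : (Module.End ℂ V)ˣ) = (k : Submodule ℂ V)},
            μ s • wbar G μ mc s) - ebar G μ mc k))
      - (∑ᶠ k ∈ {k : ↥(Pset G) |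
            (i : Submodule ℂ V) ⊓ (j : Submodule ℂ V) ≤ (k : Submodule ℂ V)},
          ((∑ᶠ s ∈ {s : ↥G | s ∈ Rset G ∧
              hypOf (s : (Module.End ℂ V)ˣ) = (k : Submodule ℂ V)},
            μ s • wbar G μ mc s) - ebar G μ mc k)) *
        ((∑ᶠ s ∈ {s : ↥G | s ∈ Rset G ∧ hypOf (s : (Module.End ℂ V)ˣ) = (a : Submodule ℂ V)},
          μ s • wbar G μ mc s) - ebar G μ mc a) = 0) := by
  have : Finite ↥(Pset G) := (Set.Finite.image _ (Set.toFinite (Rset G))).to_subtype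
  have := Fintype.ofFinite ↥G
  have := Fintype.ofFinite ↥(Pset G)
  refine ⟨?_, ?_⟩
  · intro w i j h
    rw [Tel_eq, Tel_eq, wbar_Tel G μ mc hμ]
    have : act G w i = j := Subtype.ext h
    rw [this]
  · intro i j hij a ha
    simp only [Tel_eq]
    rw [finsum_mem_filter_aux, sub_eq_zero]
    have h1 := Sel_comm_sum G μ mc hμ _ a ha
    have h2 := ebar_comm_sum G μ mc i j a hij _ rfl ha
    have h3 : Tel G μ mc a = Sel G μ mc a - ebar G μ mc a := rfl
    simp only [Set.mem_ofPred_eq]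
    conv_lhs => rw [h3, sub_mul, h1, h2, ← mul_sub, ← h3]
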